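/- arXiv:1806.03467 — 3 statements merged into one kernel-verified Lean document; each statement's English description precedes it below -/
import Mathlib

section
/- Let F : ℝ^d → ℝ be convex and differentiable, let ν₀ ∈ ℝ^d have support S, let λ > 0 satisfy λ ≥ 2‖∇F(ν₀)‖_∞, and let ν̂ be a global minimizer of ν ↦ F(ν) + λ‖ν‖₁. Then the error vector ρ = ν̂ − ν₀ lies in the cone C(S;3), i.e. ‖ρ_{S^c}‖₁ ≤ 3‖ρ_S‖₁. -/
/-- A convex function on a real normed space lies above its tangent hyperplanes. -/
theorem ConvexOn.add_fderiv_sub_le {E : Type*} [NormedAddCommGroup E] [NormedSpace ℝ E]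
    {f : E → ℝ} (hf : ConvexOn ℝ Set.univ f) {x : E} (hx : DifferentiableAt ℝ f x) (y : E) :
    f x + fderiv ℝ f x (y - x) ≤ f y := by
  have hconv : ConvexOn ℝ Set.univ (f ∘ AffineMap.lineMap (k := ℝ) x y) := by
    simpa using hf.comp_affineMap (AffineMap.lineMap (k := ℝ) x y)
  have hx' : HasFDerivAt f (fderiv ℝ f x) (AffineMap.lineMap x y (0 : ℝ)) := by
    simpa using hx.hasFDerivAt
  have hderiv : HasDerivAt (f ∘ AffineMap.lineMap (k := ℝ) x y) (fderiv ℝ f x (y - x)) 0 :=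
    hx'.comp_hasDerivAt 0 AffineMap.hasDerivAt_lineMap
  have h := hconv.le_slope_of_hasDerivAt (Set.mem_univ 0) (Set.mem_univ 1) one_pos hderiv
  simp only [slope_def_field, Function.comp_apply, AffineMap.lineMap_apply_zero,
    AffineMap.lineMap_apply_one, sub_zero, div_one] at h
  linarith

/-- Hölder's inequality for a linear functional on `ι → ℝ` whose values on the standard basis
are bounded by `c`. -/
theorem LinearMap.abs_apply_le_mul_sum_abs {ι : Type*} [Fintype ι] [DecidableEq ι]
    (L : (ι → ℝ) →ₗ[ℝ] ℝ) {c : ℝ} (hc : ∀ i, |L (Pi.single i 1)| ≤ c) (u : ι → ℝ) :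
    |L u| ≤ c * ∑ i, |u i| := by
  rw [L.pi_apply_eq_sum_univ u, Finset.mul_sum]
  refine (Finset.abs_sum_le_sum_abs _ _).trans (Finset.sum_le_sum fun i _ => ?_)
  have hsingle : (fun j => if i = j then (1 : ℝ) else 0) = Pi.single i 1 := by
    ext j
    simp [Pi.single_apply, eq_comm]
  rw [hsingle, smul_eq_mul, abs_mul, mul_comm]
  exact mul_le_mul_of_nonneg_right (hc i) (abs_nonneg _)

/-- If `v` vanishes outside `S`, then passing from `v` to `w` increases the `ℓ¹` norm by at least
`‖(w - v)_{Sᶜ}‖₁ - ‖(w - v)_S‖₁`. -/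
theorem sum_abs_sub_compl_sub_le {ι : Type*} [Fintype ι] [DecidableEq ι] {S : Finset ι}
    {v : ι → ℝ} (hv : ∀ i ∉ S, v i = 0) (w : ι → ℝ) :
    ∑ i ∈ Sᶜ, |w i - v i| - ∑ i ∈ S, |w i - v i| ≤ ∑ i, |w i| - ∑ i, |v i| := by
  have hS : ∑ i ∈ S, |v i| - ∑ i ∈ S, |w i - v i| ≤ ∑ i ∈ S, |w i| := by
    rw [← Finset.sum_sub_distrib]
    refine Finset.sum_le_sum fun i _ => ?_
    have := abs_sub_abs_le_abs_sub (v i) (w i)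
    rw [abs_sub_comm] at this
    linarith
  have hw : ∑ i ∈ Sᶜ, |w i - v i| = ∑ i ∈ Sᶜ, |w i| :=
    Finset.sum_congr rfl fun i hi => by rw [hv i (Finset.mem_compl.mp hi), sub_zero]
  have hvc : ∑ i ∈ Sᶜ, |v i| = 0 :=
    Finset.sum_eq_zero fun i hi => by rw [hv i (Finset.mem_compl.mp hi), abs_zero]
  rw [← Finset.sum_add_sum_compl S fun i => |w i|, ← Finset.sum_add_sum_compl S fun i => |v i|]
  linarith


/-- If `F` is convex and differentiable, `S` is the support of `v0`,
    `λ ≥ 2‖∇F(v0)‖_∞`, and `vhat` globally minimizes `ν ↦ F ν + λ‖ν‖₁`, then the error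
    `ρ = vhat − v0` lies in the cone `C(S;3)`, i.e. `‖ρ_{Sᶜ}‖₁ ≤ 3‖ρ_S‖₁`. -/
theorem stmt_1 (d : ℕ) (F : (Fin d → ℝ) → ℝ)
    (hconv : ConvexOn ℝ Set.univ F) (hdiff : Differentiable ℝ F)
    (v0 vhat : Fin d → ℝ) (S : Finset (Fin d)) (hS : ∀ i, i ∈ S ↔ v0 i ≠ 0)
    (lam : ℝ) (hlam_pos : 0 < lam)
    (hlam : ∀ i, 2 * |fderiv ℝ F v0 (Pi.single i 1)| ≤ lam)
    (hmin : ∀ ν, F vhat + lam * ∑ i, |vhat i| ≤ F ν + lam * ∑ i, |ν i|) :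
    ∑ i ∈ Sᶜ, |vhat i - v0 i| ≤ 3 * ∑ i ∈ S, |vhat i - v0 i| := by
  have htangent := hconv.add_fderiv_sub_le (hdiff v0) vhat
  have hgrad := LinearMap.abs_apply_le_mul_sum_abs (fderiv ℝ F v0).toLinearMap (c := lam / 2)
    (fun i => by have := hlam i; simp only [ContinuousLinearMap.coe_coe]; linarith) (vhat - v0)
  have hlower := neg_le_of_abs_le hgrad
  have hnorm := sum_abs_sub_compl_sub_le (S := S) (v := v0)
    (fun i hi => by simpa using (hS i).not.mp hi) vhat
  have hbasic := hmin v0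
  simp only [ContinuousLinearMap.coe_coe, Pi.sub_apply,
    ← Finset.sum_add_sum_compl S fun i => |vhat i - v0 i|] at hlower
  have hscaled := mul_le_mul_of_nonneg_left hnorm hlam_pos.le
  refine le_of_mul_le_mul_left ?_ hlam_pos
  linarith
end

section
/- Let A and B be real symmetric d×d matrices with |A_{ij} − B_{ij}| ≤ ε for all i, j, let S ⊆ {1,…,d} with |S| ≤ k, and suppose uᵀ B u ≥ γ ‖u‖₂² for every u in the cone C(S;3). Then for every u ∈ C(S;3), uᵀ A u ≥ (γ − 16 k ε) ‖u‖₂². -/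
open scoped Matrix

/-- A quadratic form with entries bounded by `ε` is bounded by `ε ‖u‖₁²`. -/
theorem abs_dotProduct_mulVec_le_of_abs_entry_le {n : Type*} [Fintype n] {M : Matrix n n ℝ}
    {ε : ℝ} (hM : ∀ i j, |M i j| ≤ ε) (u : n → ℝ) :
    |u ⬝ᵥ M.mulVec u| ≤ ε * (∑ i, |u i|) ^ 2 := by
  have h : u ⬝ᵥ M.mulVec u = ∑ i, ∑ j, u i * (M i j * u j) := by
    simp only [dotProduct, Matrix.mulVec, Finset.mul_sum]
  rw [h, sq, Finset.sum_mul_sum, Finset.mul_sum]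
  refine (Finset.abs_sum_le_sum_abs _ _).trans (Finset.sum_le_sum fun i _ => ?_)
  rw [Finset.mul_sum]
  refine (Finset.abs_sum_le_sum_abs _ _).trans (Finset.sum_le_sum fun j _ => ?_)
  calc |u i * (M i j * u j)| = |M i j| * (|u i| * |u j|) := by
        rw [abs_mul, abs_mul]; ring
    _ ≤ ε * (|u i| * |u j|) := by gcongr; exact hM i j

/-- On the cone `C(S;3)`, `‖u‖₁² ≤ 16 |S| ‖u‖₂²`. -/
theorem sq_sum_abs_le_of_mem_cone {n : Type*} [Fintype n] [DecidableEq n] {S : Finset n}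
    {u : n → ℝ} (hu : ∑ i ∈ Sᶜ, |u i| ≤ 3 * ∑ i ∈ S, |u i|) :
    (∑ i, |u i|) ^ 2 ≤ 16 * S.card * ∑ i, (u i) ^ 2 := by
  have hsplit := Finset.sum_add_sum_compl S fun i => |u i|
  have hle : ∑ i, |u i| ≤ 4 * ∑ i ∈ S, |u i| := by linarith
  calc (∑ i, |u i|) ^ 2 ≤ (4 * ∑ i ∈ S, |u i|) ^ 2 := by gcongr
    _ = 16 * (∑ i ∈ S, |u i|) ^ 2 := by ring
    _ ≤ 16 * (S.card * ∑ i ∈ S, |u i| ^ 2) := by gcongr; exact sq_sum_le_card_mul_sum_sq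
    _ = 16 * S.card * ∑ i ∈ S, (u i) ^ 2 := by simp only [sq_abs]; ring
    _ ≤ 16 * S.card * ∑ i, (u i) ^ 2 := by
        gcongr
        exact Finset.subset_univ S

/-- If the symmetric matrices `A` and `B` are entrywise `ε`-close, `|S| ≤ k`,
    and `uᵀBu ≥ γ‖u‖₂²` on the cone `C(S;3)`, then `uᵀAu ≥ (γ − 16kε)‖u‖₂²` on `C(S;3)`. -/
theorem stmt_4 (d k : ℕ) (A B : Matrix (Fin d) (Fin d) ℝ)
    (hA : A.IsSymm) (hB : B.IsSymm) (ε γ : ℝ)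
    (hAB : ∀ i j, |A i j - B i j| ≤ ε)
    (S : Finset (Fin d)) (hk : S.card ≤ k)
    (hBpos : ∀ u : Fin d → ℝ, (∑ i ∈ Sᶜ, |u i| ≤ 3 * ∑ i ∈ S, |u i|) →
      γ * ∑ i, (u i) ^ 2 ≤ u ⬝ᵥ B.mulVec u) :
    ∀ u : Fin d → ℝ, (∑ i ∈ Sᶜ, |u i| ≤ 3 * ∑ i ∈ S, |u i|) →
      (γ - 16 * k * ε) * ∑ i, (u i) ^ 2 ≤ u ⬝ᵥ A.mulVec u := by
  intro u hu
  rcases Nat.eq_zero_or_pos d with rfl | hd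
  · simp
  have hε : 0 ≤ ε := (abs_nonneg _).trans (hAB ⟨0, hd⟩ ⟨0, hd⟩)
  have hquad : |u ⬝ᵥ (A - B).mulVec u| ≤ ε * (∑ i, |u i|) ^ 2 :=
    abs_dotProduct_mulVec_le_of_abs_entry_le (fun i j => by simpa using hAB i j) u
  rw [Matrix.sub_mulVec, dotProduct_sub] at hquad
  have hnorm : ε * (∑ i, |u i|) ^ 2 ≤ ε * (16 * k * ∑ i, (u i) ^ 2) := by
    refine mul_le_mul_of_nonneg_left ((sq_sum_abs_le_of_mem_cone hu).trans ?_) hε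
    gcongr
  linarith [hBpos u hu, (abs_le.mp hquad).1]
end

section
/- (Deterministic core of the Taylor-expansion lemma under orthogonality.) Let f : ℝ^p × ℝ^ℓ → ℝ^p be twice continuously differentiable, let (θ₀, h₀) ∈ ℝ^p × ℝ^ℓ satisfy f(θ₀, h₀) = 0, and suppose the partial derivative of f in its second argument vanishes at (θ₀, h₀) (orthogonality): ∇_h f(θ₀, h₀) = 0. Suppose further that for each coordinate j ∈ {1,…,p} the Hessian of f_j (as a function on ℝ^p × ℝ^ℓ) has operator norm at most H everywhere, and that the Jacobian M = ∇_θ f(θ₀, h₀) (a p×p matrix) is invertible. Then for all (θ, h) ∈ ℝ^p × ℝ^ℓ, ‖(θ − θ₀) − M⁻¹ f(θ, h)‖ ≤ (√p · H / 2) · ‖M⁻¹‖_{op} · (‖θ − θ₀‖ + ‖h − h₀‖)². -/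
/-- Second-order Taylor bound: a `C²` map whose second derivative is bounded by `H` differs from
its affine approximation by at most `H / 2 * ‖v‖ ^ 2`. -/
theorem norm_sub_sub_fderiv_le_of_norm_fderiv_fderiv_le {E F : Type*}
    [NormedAddCommGroup E] [NormedSpace ℝ E] [NormedAddCommGroup F] [NormedSpace ℝ F]
    {g : E → F} (hg : ContDiff ℝ 2 g) {H : ℝ}
    (hH : ∀ x, ‖fderiv ℝ (fderiv ℝ g) x‖ ≤ H) (x v : E) :
    ‖g (x + v) - g x - fderiv ℝ g x v‖ ≤ H / 2 * ‖v‖ ^ 2 := by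
  have hd : Differentiable ℝ g := hg.differentiable (by norm_num)
  have hd' : Differentiable ℝ (fderiv ℝ g) :=
    (hg.fderiv_right (m := 1) (by norm_num)).differentiable (by norm_num)
  have hlip : ∀ y, ‖fderiv ℝ g y - fderiv ℝ g x‖ ≤ H * ‖y - x‖ := fun y =>
    convex_univ.norm_image_sub_le_of_norm_fderiv_le (fun z _ => hd' z) (fun z _ => hH z)
      (Set.mem_univ x) (Set.mem_univ y)
  have hφ : ∀ t : ℝ, HasDerivAt (fun t : ℝ => g (x + t • v) - g x - t • fderiv ℝ g x v)
      (fderiv ℝ g (x + t • v) v - fderiv ℝ g x v) t := by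
    intro t
    have hline : HasDerivAt (fun t : ℝ => x + t • v) v t := by
      simpa using ((hasDerivAt_id t).smul_const v).const_add x
    have hlin : HasDerivAt (fun t : ℝ => t • fderiv ℝ g x v) (fderiv ℝ g x v) t := by
      simpa using (hasDerivAt_id t).smul_const (fderiv ℝ g x v)
    exact (((hd _).hasFDerivAt.comp_hasDerivAt t hline).sub_const (g x)).sub hlin
  have hB : ∀ t : ℝ, HasDerivAt (fun t : ℝ => H / 2 * ‖v‖ ^ 2 * t ^ 2) (H * ‖v‖ ^ 2 * t) t := by
    intro t
    refine ((hasDerivAt_pow 2 t).const_mul (H / 2 * ‖v‖ ^ 2)).congr_deriv ?_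
    push_cast
    ring
  have key := image_norm_le_of_norm_deriv_right_le_deriv_boundary (a := 0) (b := 1)
    (fun t _ => (hφ t).continuousAt.continuousWithinAt)
    (fun t _ => (hφ t).hasDerivWithinAt) (by simp) hB
    (fun t ht => by
      rw [← sub_apply]
      calc ‖(fderiv ℝ g (x + t • v) - fderiv ℝ g x) v‖
          ≤ ‖fderiv ℝ g (x + t • v) - fderiv ℝ g x‖ * ‖v‖ := ContinuousLinearMap.le_opNorm _ _
        _ ≤ H * ‖x + t • v - x‖ * ‖v‖ := by gcongr; exact hlip _
        _ = H * ‖v‖ ^ 2 * t := by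
          rw [add_sub_cancel_left, norm_smul, Real.norm_of_nonneg ht.1]
          ring)
    (Set.right_mem_Icc.2 zero_le_one)
  simpa using key

/-- The Euclidean norm is at most `√p` times any bound on the coordinates. -/
theorem EuclideanSpace.norm_le_sqrt_mul_of_norm_apply_le {p : ℕ} {C : ℝ}
    (w : EuclideanSpace ℝ (Fin p)) (hw : ∀ j, ‖w j‖ ≤ C) : ‖w‖ ≤ √p * C := by
  rcases isEmpty_or_nonempty (Fin p) with hp | ⟨⟨j⟩⟩
  · obtain rfl : p = 0 := by
      rw [← Fintype.card_fin p, Fintype.card_eq_zero_iff]; exact hp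
    simp [EuclideanSpace.norm_eq]
  · have hC : 0 ≤ C := (norm_nonneg _).trans (hw j)
    rw [EuclideanSpace.norm_eq, ← Real.sqrt_sq hC, ← Real.sqrt_mul (Nat.cast_nonneg p)]
    refine Real.sqrt_le_sqrt ?_
    calc ∑ i, ‖w i‖ ^ 2 ≤ ∑ _i : Fin p, C ^ 2 := by gcongr with i; exact hw i
      _ = p * C ^ 2 := by simp


/-- deterministic core of the Taylor-expansion lemma under orthogonality:
    if `f : ℝ^p × ℝ^ℓ → ℝ^p` is `C²` with `f(θ₀,h₀) = 0`, the partial derivative in the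
    nuisance direction vanishes at `(θ₀,h₀)`, each coordinate has Hessian operator norm at
    most `H` everywhere, and the Jacobian `M = ∇_θ f(θ₀,h₀)` is invertible, then
    `‖(θ − θ₀) − M⁻¹ f(θ,h)‖ ≤ (√p·H/2)‖M⁻¹‖_op (‖θ − θ₀‖ + ‖h − h₀‖)²`. -/
theorem stmt_11 (p l : ℕ)
    (f : EuclideanSpace ℝ (Fin p) × EuclideanSpace ℝ (Fin l) → EuclideanSpace ℝ (Fin p))
    (hf : ContDiff ℝ 2 f)
    (θ₀ : EuclideanSpace ℝ (Fin p)) (h₀ : EuclideanSpace ℝ (Fin l))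
    (hzero : f (θ₀, h₀) = 0)
    (horth : ∀ k : EuclideanSpace ℝ (Fin l), fderiv ℝ f (θ₀, h₀) (0, k) = 0)
    (M : EuclideanSpace ℝ (Fin p) ≃L[ℝ] EuclideanSpace ℝ (Fin p))
    (hM : ∀ v, M v = fderiv ℝ f (θ₀, h₀) (v, 0))
    (H : ℝ)
    (hHess : ∀ (j : Fin p) (x : EuclideanSpace ℝ (Fin p) × EuclideanSpace ℝ (Fin l)),
      ‖fderiv ℝ (fderiv ℝ (fun y => f y j)) x‖ ≤ H) :
    ∀ (θ : EuclideanSpace ℝ (Fin p)) (h : EuclideanSpace ℝ (Fin l)),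
      ‖(θ - θ₀) - M.symm (f (θ, h))‖ ≤
        Real.sqrt p * H / 2 *
          ‖(M.symm : EuclideanSpace ℝ (Fin p) →L[ℝ] EuclideanSpace ℝ (Fin p))‖ *
          (‖θ - θ₀‖ + ‖h - h₀‖) ^ 2 := by
  intro θ h
  set x₀ := (θ₀, h₀)
  set v := (θ - θ₀, h - h₀) with hv
  have hxv : x₀ + v = (θ, h) := by simp [x₀, hv]
  have hMv : fderiv ℝ f x₀ v = M (θ - θ₀) := by
    rw [hM, ← add_zero (fderiv ℝ f x₀ (θ - θ₀, 0)), ← horth (h - h₀), ← map_add]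
    simp [hv]
  have hnv : ‖v‖ ≤ ‖θ - θ₀‖ + ‖h - h₀‖ :=
    max_le_add_of_nonneg (norm_nonneg _) (norm_nonneg _)
  have hcoord : ∀ j, ‖(f (θ, h) - M (θ - θ₀)) j‖ ≤ H / 2 * (‖θ - θ₀‖ + ‖h - h₀‖) ^ 2 := by
    intro j
    have hHj : ∀ x, ‖fderiv ℝ (fderiv ℝ (fun y => (f y j : ℝ))) x‖ ≤ H := hHess j
    have hH : 0 ≤ H := le_trans (norm_nonneg (fderiv ℝ (fderiv ℝ (fun y => f y j)) x₀)) (hHj x₀)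
    have hfj : fderiv ℝ (fun y => f y j) x₀ v = fderiv ℝ f x₀ v j := by
      have := ((EuclideanSpace.proj j : EuclideanSpace ℝ (Fin p) →L[ℝ] ℝ).hasFDerivAt.comp x₀
        (hf.differentiable (by norm_num) x₀).hasFDerivAt).fderiv
      exact congrArg (fun L => L v) this
    have hT := norm_sub_sub_fderiv_le_of_norm_fderiv_fderiv_le
      (contDiff_euclidean.1 hf j) hHj x₀ v
    rw [hfj, hMv, hxv, hzero, PiLp.zero_apply, sub_zero] at hT
    exact hT.trans (by gcongr)
  have hinv : (θ - θ₀) - M.symm (f (θ, h)) = -M.symm (f (θ, h) - M (θ - θ₀)) := by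
    simp
  rw [hinv, norm_neg]
  calc ‖M.symm (f (θ, h) - M (θ - θ₀))‖
      ≤ ‖(M.symm : EuclideanSpace ℝ (Fin p) →L[ℝ] EuclideanSpace ℝ (Fin p))‖ *
          ‖f (θ, h) - M (θ - θ₀)‖ :=
        (M.symm : EuclideanSpace ℝ (Fin p) →L[ℝ] EuclideanSpace ℝ (Fin p)).le_opNorm _
    _ ≤ ‖(M.symm : EuclideanSpace ℝ (Fin p) →L[ℝ] EuclideanSpace ℝ (Fin p))‖ *
          (√p * (H / 2 * (‖θ - θ₀‖ + ‖h - h₀‖) ^ 2)) := by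
        gcongr
        exact EuclideanSpace.norm_le_sqrt_mul_of_norm_apply_le _ hcoord
    _ = _ := by ring
end
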